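/- For every graph H with at least one edge there exist constants c > 0 and γ > 0 such that for all sufficiently large n and every integer b with 1 ≤ b ≤ c·n^{1/m(H)}, in the b-Waiter-Client game played on the edge set of the complete graph K_n, Waiter can ensure that Client's final graph G contains at least γ·n^{v(H)}/b^{e(H)} subgraphs isomorphic to H. -/

import Mathlib

/-!
Common definitions:
* A formal model of the `b`-Waiter-Client game on a finite board.
* Complete `H`-partite graphs `K_n^H`, canonical copies of induced subgraphs,
  canonical copies of the overlap graphs `H^J`, and the associated counting functions.
-/

namespace WCGame

variable {X : Type*} [DecidableEq X]

/-- A history of play: the list of rounds so far, each round consisting of the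
set of elements offered by Waiter together with the element chosen by Client. -/
abbrev Hist (X : Type*) := List (Finset X × X)

/-- All elements offered so far during a history. -/
def offeredSet (h : Hist X) : Finset X := h.foldr (fun r acc => r.1 ∪ acc) ∅

/-- A Waiter strategy: to every history it assigns either a set of elements to
offer next, or `none`, meaning that Waiter declares the game over. -/
abbrev WaiterStrategy (X : Type*) := Hist X → Option (Finset X)

/-- A Client strategy: to every history and currently offered set it assigns
the element of that set that Client picks. -/
abbrev ClientStrategy (X : Type*) := Hist X → Finset X → X

/-- A Waiter strategy is legal (for board `board` and parameter `b`) if every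
set it offers consists of exactly `b` elements of the board which were not
offered in any previous round.  (Waiter may always stop instead, in particular
when fewer than `b` unoffered elements remain no legal offer exists and a legal
Waiter strategy must stop.) -/
def WaiterLegal (board : Finset X) (b : ℕ) (W : WaiterStrategy X) : Prop :=
  ∀ h O, W h = some O → O.card = b ∧ O ⊆ board ∧ Disjoint O (offeredSet h)

/-- A Client strategy is legal if it always picks an element of the offered set. -/
def ClientLegal (C : ClientStrategy X) : Prop :=
  ∀ h O, O.Nonempty → C h O ∈ O

/-- Playing the game for at most `fuel` further rounds from a given history. -/
def playAux (W : WaiterStrategy X) (C : ClientStrategy X) : ℕ → Hist X → Hist X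
  | 0, h => h
  | fuel + 1, h =>
    match W h with
    | none => h
    | some O => playAux W C fuel (h ++ [(O, C h O)])

/-- Client's final set `S`: the set of all elements chosen by Client during the
whole game.  (For a legal Waiter strategy with `b ≥ 1` the game lasts at most
`board.card` rounds, so the fuel `board.card` never truncates the game.) -/
def finalSet (board : Finset X) (W : WaiterStrategy X) (C : ClientStrategy X) : Finset X :=
  ((playAux W C board.card []).map Prod.snd).toFinset

/-- Waiter can ensure that Client's final set has property `P` in the
`b`-Waiter-Client game on `board`. -/
def WaiterCanEnsure (board : Finset X) (b : ℕ) (P : Finset X → Prop) : Prop :=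
  ∃ W : WaiterStrategy X, WaiterLegal board b W ∧
    ∀ C : ClientStrategy X, ClientLegal C → P (finalSet board W C)

end WCGame

namespace GraphDefs

variable {α : Type*} [Fintype α] [DecidableEq α]

/-- The maximum density `m(H) = max { e(H')/v(H') : H' ⊆ H, v(H') ≥ 1 }`. -/
noncomputable def maxDensity (H : SimpleGraph α) : ℝ :=
  sSup { d : ℝ | ∃ H' : H.Subgraph, H'.verts.Nonempty ∧
          d = (H'.edgeSet.ncard : ℝ) / (H'.verts.ncard : ℝ) }

/-- The complete `H`-partite graph `K_n^H`: the part `V_a` corresponding to a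
vertex `a` of `H` is `{a} × Fin n`, and `(a,i)` is adjacent to `(b,j)` iff
`a` and `b` are adjacent in `H`. -/
def Kpart (H : SimpleGraph α) (n : ℕ) : SimpleGraph (α × Fin n) :=
  SimpleGraph.comap Prod.fst H

/-- Number of edges of the induced subgraph `H[s]`, i.e. edges of `H` with both
endpoints in `s`. -/
noncomputable def eIn (H : SimpleGraph α) (s : Set α) : ℕ :=
  {e ∈ H.edgeSet | ∀ v ∈ e, v ∈ s}.ncard

/-- Canonical copies of the induced subgraph `H[s]` in `G ⊆ K_n^H`.
A canonical copy is an (automatically injective) edge-preserving map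
`a ↦ (a, f a)` sending each vertex `a ∈ s` into its part `V_a`; it is thus
faithfully encoded by the function `f : s → Fin n` of second coordinates. -/
def canonCopies (H : SimpleGraph α) (n : ℕ) (G : SimpleGraph (α × Fin n)) (s : Set α) :
    Set (s → Fin n) :=
  { f | ∀ a b : s, H.Adj a b → G.Adj ((a : α), f a) ((b : α), f b) }

/-- `N_G(H[s])`: the number of canonical copies of the induced subgraph `H[s]` in `G`. -/
noncomputable def NCopies (H : SimpleGraph α) (n : ℕ) (G : SimpleGraph (α × Fin n))
    (s : Set α) : ℕ :=
  (canonCopies H n G s).ncard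

/-- The canonical copy encoded by `f` contains the vertex `(x, u)` of `K_n^H`. -/
def containsVtx {n : ℕ} (s : Set α) (f : s → Fin n) (x : α) (u : Fin n) : Prop :=
  ∃ a : s, (a : α) = x ∧ f a = u

/-- `deg_G(v, H[s])` for the pair of vertices `v = ((x,u),(y,w))`: the number of
canonical copies of `H[s]` in `G` containing both vertices. -/
noncomputable def degPair (H : SimpleGraph α) (n : ℕ) (G : SimpleGraph (α × Fin n)) (s : Set α)
    (x : α) (u : Fin n) (y : α) (w : Fin n) : ℕ :=
  {f ∈ canonCopies H n G s | containsVtx s f x u ∧ containsVtx s f y w}.ncard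

/-- Canonical copies of `H^J` (`J = H[s]`) in `G ⊆ K_n^H`.  A canonical copy of
`H^J` is faithfully encoded by the pair `(f, f')` of (second coordinates of)
canonical copies of `H` given by its restrictions to the two overlapping copies
of `H`; injectivity is equivalent to `f` and `f'` agreeing exactly on `s`. -/
def overlapCopies (H : SimpleGraph α) (n : ℕ) (G : SimpleGraph (α × Fin n)) (s : Set α) :
    Set ((α → Fin n) × (α → Fin n)) :=
  { ff | (∀ a b : α, H.Adj a b → G.Adj (a, ff.1 a) (b, ff.1 b)) ∧
         (∀ a b : α, H.Adj a b → G.Adj (a, ff.2 a) (b, ff.2 b)) ∧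
         (∀ a ∈ s, ff.1 a = ff.2 a) ∧ (∀ a ∉ s, ff.1 a ≠ ff.2 a) }

/-- `N_G(H^J)` for `J = H[s]`: the number of canonical copies of `H^J` in `G`. -/
noncomputable def NOverlap (H : SimpleGraph α) (n : ℕ) (G : SimpleGraph (α × Fin n))
    (s : Set α) : ℕ :=
  (overlapCopies H n G s).ncard

/-- `deg_G(v, H^J)` for the pair of vertices `v = ((x,u),(y,w))`: the number of
canonical copies of `H^J` in `G` containing both vertices. -/
noncomputable def degPairOverlap (H : SimpleGraph α) (n : ℕ) (G : SimpleGraph (α × Fin n))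
    (s : Set α) (x : α) (u : Fin n) (y : α) (w : Fin n) : ℕ :=
  {ff ∈ overlapCopies H n G s | (ff.1 x = u ∨ ff.2 x = u) ∧ (ff.1 y = w ∨ ff.2 y = w)}.ncard

/-- The graph obtained from `Ge` by adding, for each pair `(u,w) ∈ R`, the edge
between `(x,u) ∈ V_x` and `(y,w) ∈ V_y`. -/
def addPairs {n : ℕ} (Ge : SimpleGraph (α × Fin n)) (x y : α)
    (R : Set (Fin n × Fin n)) : SimpleGraph (α × Fin n) :=
  Ge ⊔ SimpleGraph.fromEdgeSet { p : Sym2 (α × Fin n) | ∃ r ∈ R, p = s((x, r.1), (y, r.2)) }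

/-- The edge set of a graph on a finite vertex type, as a finset (the board of
the Waiter-Client game played on the edges of this graph). -/
noncomputable def edgeBoard {β : Type*} (G : SimpleGraph β) [Finite β] : Finset (Sym2 β) :=
  (Set.toFinite G.edgeSet).toFinset

/-- The number of subgraphs of `G` isomorphic to `H`. -/
noncomputable def copyCount {β : Type*} (G : SimpleGraph β) (H : SimpleGraph α) : ℕ :=
  Set.ncard { G' : G.Subgraph | Nonempty (G'.coe ≃g H) }

end GraphDefs

namespace WCGame

section Positions

variable {X : Type*} [DecidableEq X]

/-- `WaiterWins b P S U`: from the position in which Client owns `S` and the elements of `U`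
are still available, Waiter can ensure that Client's final set satisfies `P`. -/
inductive WaiterWins (b : ℕ) (P : Finset X → Prop) : Finset X → Finset X → Prop
  | finish {S U : Finset X} : P S → WaiterWins b P S U
  | offer {S U : Finset X} (B : Finset X) : B ⊆ U → B.card = b →
      (∀ g ∈ B, WaiterWins b P (insert g S) (U \ B)) → WaiterWins b P S U

lemma WaiterWins.mono {b : ℕ} {P : Finset X → Prop} {S U : Finset X}
    (h : WaiterWins b P S U) : ∀ {U' : Finset X}, U ⊆ U' → WaiterWins b P S U' := by
  induction h with
  | finish h => exact fun _ => .finish h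
  | offer B hB hc _ ih =>
    exact fun hU => .offer B (hB.trans hU) hc
      fun g hg => ih g hg (Finset.sdiff_subset_sdiff hU subset_rfl)

/-- Client's set after a history of play. -/
def pickedSet (h : Hist X) : Finset X := (h.map Prod.snd).toFinset

lemma pickedSet_append (h : Hist X) (O : Finset X) (x : X) :
    pickedSet (h ++ [(O, x)]) = insert x (pickedSet h) := by
  ext y
  simp [pickedSet]

lemma offeredSet_append (h : Hist X) (O : Finset X) (x : X) :
    offeredSet (h ++ [(O, x)]) = O ∪ offeredSet h := by
  induction h with
  | nil => simp [offeredSet]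
  | cons r t ih =>
    have e : offeredSet (r :: t ++ [(O, x)]) = r.1 ∪ offeredSet (t ++ [(O, x)]) := rfl
    have e' : offeredSet (r :: t) = r.1 ∪ offeredSet t := rfl
    rw [e, e', ih, Finset.union_left_comm]

/-- `O` is an offer keeping the position after history `h` winning for Waiter. -/
def GoodOffer (board : Finset X) (b : ℕ) (P : Finset X → Prop) (h : Hist X)
    (O : Finset X) : Prop :=
  O ⊆ board \ offeredSet h ∧ O.card = b ∧
    ∀ g ∈ O, WaiterWins b P (insert g (pickedSet h)) ((board \ offeredSet h) \ O)

open Classical in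
/-- The Waiter strategy which stops as soon as `P` holds and otherwise makes a good offer. -/
noncomputable def goodStrategy (board : Finset X) (b : ℕ) (P : Finset X → Prop) :
    WaiterStrategy X := fun h =>
  if P (pickedSet h) then none
  else if hO : ∃ O, GoodOffer board b P h O then some hO.choose else none

lemma goodStrategy_eq_some {board : Finset X} {b : ℕ} {P : Finset X → Prop} {h : Hist X}
    {O : Finset X} (hO : goodStrategy board b P h = some O) : GoodOffer board b P h O := by
  unfold goodStrategy at hO
  split_ifs at hO with h1 h2
  cases hO
  exact h2.choose_spec

lemma goodStrategy_eq_none {board : Finset X} {b : ℕ} {P : Finset X → Prop} {h : Hist X}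
    (hO : goodStrategy board b P h = none)
    (hw : WaiterWins b P (pickedSet h) (board \ offeredSet h)) : P (pickedSet h) := by
  unfold goodStrategy at hO
  split_ifs at hO with h1 h2
  · exact h1
  · cases hw with
    | finish h => exact h
    | offer B hB hc hg => exact absurd ⟨B, hB, hc, hg⟩ h2

lemma playAux_goodStrategy {board : Finset X} {b : ℕ} {P : Finset X → Prop} (hb : 1 ≤ b)
    {C : ClientStrategy X} (hC : ClientLegal C) (fuel : ℕ) (h : Hist X)
    (hcard : (board \ offeredSet h).card ≤ fuel)
    (hw : WaiterWins b P (pickedSet h) (board \ offeredSet h)) :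
    P (pickedSet (playAux (goodStrategy board b P) C fuel h)) := by
  induction fuel generalizing h with
  | zero =>
    have h0 : board \ offeredSet h = ∅ := Finset.card_eq_zero.1 (Nat.le_zero.1 hcard)
    rw [h0] at hw
    cases hw with
    | finish h => exact h
    | offer B hB hc hg =>
      rw [Finset.subset_empty.1 hB, Finset.card_empty] at hc
      omega
  | succ fuel ih =>
    unfold playAux
    split
    · next heq => exact goodStrategy_eq_none heq hw
    · next O heq =>
      obtain ⟨hO, hOc, hOw⟩ := goodStrategy_eq_some heq
      have hne : O.Nonempty := Finset.card_pos.1 (by omega)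
      have hU : board \ offeredSet (h ++ [(O, C h O)]) = (board \ offeredSet h) \ O := by
        rw [offeredSet_append, sdiff_sdiff_left, Finset.sup_eq_union, Finset.union_comm]
      apply ih
      · rw [hU, Finset.card_sdiff_of_subset hO]
        omega
      · rw [hU, pickedSet_append]
        exact hOw _ (hC h O hne)

theorem WaiterWins.waiterCanEnsure {board : Finset X} {b : ℕ} {P : Finset X → Prop}
    (hb : 1 ≤ b) (hw : WaiterWins b P ∅ board) : WaiterCanEnsure board b P := by
  refine ⟨goodStrategy board b P, fun h O hO => ?_, fun C hC => ?_⟩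
  · obtain ⟨h1, h2, -⟩ := goodStrategy_eq_some hO
    exact ⟨h2, h1.trans Finset.sdiff_subset,
      Finset.disjoint_of_subset_left h1 Finset.sdiff_disjoint⟩
  · exact playAux_goodStrategy hb hC _ [] (by simp [offeredSet])
      (by simpa [offeredSet, pickedSet] using hw)

end Positions

section Potential

variable {X κ : Type*} [DecidableEq X] [Fintype κ]

/-- The multilinear polynomial with monomials `A t` and coefficients `c t`. -/
noncomputable def poly (A : κ → Finset X) (c : κ → ℝ) (p : X → ℝ) : ℝ :=
  ∑ t, c t * ∏ e ∈ A t, p e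

/-- The partial derivative of `poly A c` in direction `g`. -/
noncomputable def polyDeriv (A : κ → Finset X) (c : κ → ℝ) (p : X → ℝ) (g : X) : ℝ :=
  ∑ t, if g ∈ A t then c t * ∏ e ∈ (A t).erase g, p e else 0

/-- The total weight of the monomials of `poly A c` containing both `g` and `h`. -/
noncomputable def polyPair (A : κ → Finset X) (c : κ → ℝ) (p : X → ℝ) (gh : X × X) : ℝ :=
  ∑ t, if gh.1 ∈ A t ∧ gh.2 ∈ A t then c t * ∏ e ∈ A t, p e else 0

variable {A : κ → Finset X} {c : κ → ℝ} {p p' : X → ℝ}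

lemma poly_discard {g : X} (hg : p' g = 0) (hp : ∀ e, e ≠ g → p' e = p e) :
    poly A c p' = poly A c p - p g * polyDeriv A c p g := by
  unfold poly polyDeriv
  rw [Finset.mul_sum, ← Finset.sum_sub_distrib]
  refine Finset.sum_congr rfl fun t _ => ?_
  split_ifs with h
  · rw [Finset.prod_eq_zero h hg, ← Finset.mul_prod_erase _ _ h]
    ring
  · rw [Finset.prod_congr rfl fun e he => hp e (by rintro rfl; exact h he)]
    ring

/-- The number of elements of `B` in `s`, weighted by the product over `s`. -/
lemma mul_sum_prod_erase {r : ℝ} {B s : Finset X} (hB : ∀ h ∈ B, p h = r) :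
    r * ∑ h ∈ B, (if h ∈ s then ∏ e ∈ s.erase h, p e else 0)
      = ((s ∩ B).card : ℝ) * ∏ e ∈ s, p e := by
  rw [Finset.mul_sum, ← nsmul_eq_mul, ← Finset.sum_const, Finset.inter_comm,
    ← Finset.filter_mem_eq_inter, Finset.sum_filter]
  refine Finset.sum_congr rfl fun h hh => ?_
  split_ifs with h1
  · rw [← hB h hh, Finset.mul_prod_erase _ _ h1]
  · simp

lemma sum_offDiag_ite {B s : Finset X} (w : ℝ) :
    ∑ gh ∈ B.offDiag, (if gh.1 ∈ s ∧ gh.2 ∈ s then w else 0)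
      = ((s ∩ B).card : ℝ) * (((s ∩ B).card : ℝ) - 1) * w := by
  rw [← Finset.sum_filter, Finset.sum_const, nsmul_eq_mul]
  have : B.offDiag.filter (fun gh => gh.1 ∈ s ∧ gh.2 ∈ s) = (s ∩ B).offDiag := by
    ext ⟨a, b⟩
    simp only [Finset.mem_filter, Finset.mem_offDiag, Finset.mem_inter]
    tauto
  rw [this, Finset.offDiag_card, Nat.cast_sub (Nat.le_mul_self _)]
  push_cast
  ring

/-- Effect on a monomial of choosing `g` from the offered set `B`. -/
lemma prod_offer_eq {B s : Finset X} {g : X} (hg : g ∈ B) (hg1 : p' g = 1)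
    (hB0 : ∀ h ∈ B, h ≠ g → p' h = 0) (hp : ∀ e ∉ B, p' e = p e)
    (hs : (s ∩ B).card ≤ 1) :
    ∏ e ∈ s, p' e = (1 - ((s ∩ B).card : ℝ)) * (∏ e ∈ s, p e)
      + if g ∈ s then ∏ e ∈ s.erase g, p e else 0 := by
  rcases Nat.le_one_iff_eq_zero_or_eq_one.1 hs with h0 | h1
  · have hd : ∀ e ∈ s, e ∉ B := fun e he heB => by
      have := Finset.card_eq_zero.1 h0 ▸ Finset.mem_inter.2 ⟨he, heB⟩
      simp at this
    rw [h0, if_neg fun h => hd g h hg, Finset.prod_congr rfl fun e he => hp e (hd e he)]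
    simp
  · obtain ⟨h, hh⟩ := Finset.card_eq_one.1 h1
    have hmem : h ∈ s ∩ B := by simp [hh]
    obtain ⟨hhs, hhB⟩ := Finset.mem_inter.1 hmem
    have huniq : ∀ e ∈ s, e ∈ B → e = h := fun e he heB => by
      simpa [hh] using Finset.mem_inter.2 ⟨he, heB⟩
    rw [h1]
    by_cases hgh : h = g
    · subst hgh
      rw [if_pos hhs, ← Finset.mul_prod_erase _ _ hhs, hg1]
      rw [Finset.prod_congr rfl fun e he => hp e fun heB =>
        Finset.ne_of_mem_erase he (huniq e (Finset.mem_of_mem_erase he) heB)]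
      simp
    · rw [Finset.prod_eq_zero hhs (hB0 h hhB hgh),
        if_neg fun hgs => hgh (huniq g hgs hg).symm]
      simp

lemma prod_offer_le {B s : Finset X} {g : X} (hp0 : ∀ e, 0 ≤ p e) (hg : g ∈ B)
    (hg1 : p' g = 1) (hB0 : ∀ h ∈ B, h ≠ g → p' h = 0) (hp : ∀ e ∉ B, p' e = p e) :
    ∏ e ∈ s, p' e ≤ (1 - ((s ∩ B).card : ℝ)) * (∏ e ∈ s, p e)
      + ((s ∩ B).card : ℝ) * (((s ∩ B).card : ℝ) - 1) * (∏ e ∈ s, p e)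
      + if g ∈ s then ∏ e ∈ s.erase g, p e else 0 := by
  have hnn : 0 ≤ ∏ e ∈ s, p e := Finset.prod_nonneg fun e _ => hp0 e
  by_cases hs : (s ∩ B).card ≤ 1
  · rw [prod_offer_eq hg hg1 hB0 hp hs]
    have : ((s ∩ B).card : ℝ) * (((s ∩ B).card : ℝ) - 1) = 0 := by
      rcases Nat.le_one_iff_eq_zero_or_eq_one.1 hs with h | h <;> simp [h]
    rw [this]
    simp
  · obtain ⟨h, hh, hhg⟩ := Finset.exists_mem_ne (not_le.1 hs) g
    obtain ⟨hhs, hhB⟩ := Finset.mem_inter.1 hh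
    rw [Finset.prod_eq_zero hhs (hB0 h hhB hhg)]
    have h2 : 0 ≤ if g ∈ s then ∏ e ∈ s.erase g, p e else 0 := by
      split_ifs
      · exact Finset.prod_nonneg fun e _ => hp0 e
      · rfl
    nlinarith [mul_nonneg (sq_nonneg (((s ∩ B).card : ℝ) - 1)) hnn]

lemma mul_sum_polyDeriv {r : ℝ} {B : Finset X} (hB : ∀ h ∈ B, p h = r) :
    r * ∑ h ∈ B, polyDeriv A c p h
      = ∑ t, c t * (((A t ∩ B).card : ℝ) * ∏ e ∈ A t, p e) := by
  unfold polyDeriv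
  rw [Finset.sum_comm, Finset.mul_sum]
  refine Finset.sum_congr rfl fun t _ => ?_
  rw [← mul_sum_prod_erase hB, Finset.mul_sum, Finset.mul_sum, Finset.mul_sum]
  refine Finset.sum_congr rfl fun h _ => ?_
  split_ifs <;> ring

lemma sum_polyPair (B : Finset X) :
    ∑ gh ∈ B.offDiag, polyPair A c p gh
      = ∑ t, c t * (((A t ∩ B).card : ℝ) * (((A t ∩ B).card : ℝ) - 1) * ∏ e ∈ A t, p e) := by
  unfold polyPair
  rw [Finset.sum_comm]
  refine Finset.sum_congr rfl fun t _ => ?_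
  rw [sum_offDiag_ite]
  ring

lemma poly_offer_eq {r : ℝ} {B : Finset X} {g : X} (hr : ∀ h ∈ B, p h = r) (hg : g ∈ B)
    (hg1 : p' g = 1) (hB0 : ∀ h ∈ B, h ≠ g → p' h = 0) (hp : ∀ e ∉ B, p' e = p e)
    (hA : ∀ t, (A t ∩ B).card ≤ 1) :
    poly A c p' = poly A c p + polyDeriv A c p g - r * ∑ h ∈ B, polyDeriv A c p h := by
  rw [mul_sum_polyDeriv hr]
  unfold poly polyDeriv
  rw [← Finset.sum_add_distrib, ← Finset.sum_sub_distrib]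
  refine Finset.sum_congr rfl fun t _ => ?_
  rw [prod_offer_eq hg hg1 hB0 hp (hA t)]
  split_ifs <;> ring

lemma poly_offer_le {r : ℝ} {B : Finset X} {g : X} (hc : ∀ t, 0 ≤ c t) (hp0 : ∀ e, 0 ≤ p e)
    (hr : ∀ h ∈ B, p h = r) (hg : g ∈ B)
    (hg1 : p' g = 1) (hB0 : ∀ h ∈ B, h ≠ g → p' h = 0) (hp : ∀ e ∉ B, p' e = p e) :
    poly A c p' ≤ poly A c p + polyDeriv A c p g - r * ∑ h ∈ B, polyDeriv A c p h
      + ∑ gh ∈ B.offDiag, polyPair A c p gh := by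
  rw [mul_sum_polyDeriv hr, sum_polyPair]
  unfold poly polyDeriv
  rw [← Finset.sum_add_distrib, ← Finset.sum_sub_distrib, ← Finset.sum_add_distrib]
  refine Finset.sum_le_sum fun t _ => ?_
  refine (mul_le_mul_of_nonneg_left (prod_offer_le hp0 hg hg1 hB0 hp) (hc t)).trans
    (le_of_eq ?_)
  split_ifs <;> ring

lemma polyDeriv_nonneg (hc : ∀ t, 0 ≤ c t) (hp0 : ∀ e, 0 ≤ p e) (g : X) :
    0 ≤ polyDeriv A c p g := by
  refine Finset.sum_nonneg fun t _ => ?_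
  split_ifs
  · exact mul_nonneg (hc t) (Finset.prod_nonneg fun e _ => hp0 e)
  · rfl

lemma polyPair_nonneg (hc : ∀ t, 0 ≤ c t) (hp0 : ∀ e, 0 ≤ p e) (gh : X × X) :
    0 ≤ polyPair A c p gh := by
  refine Finset.sum_nonneg fun t _ => ?_
  split_ifs
  · exact mul_nonneg (hc t) (Finset.prod_nonneg fun e _ => hp0 e)
  · rfl

lemma prod_mul_prod_le_prod_union (hp0 : ∀ e, 0 ≤ p e) (hp1 : ∀ e, p e ≤ 1)
    (s t : Finset X) : (∏ e ∈ s, p e) * ∏ e ∈ t, p e ≤ ∏ e ∈ s ∪ t, p e := by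
  rw [← Finset.prod_union_inter]
  exact mul_le_of_le_one_right (Finset.prod_nonneg fun e _ => hp0 e)
    (Finset.prod_le_one (fun e _ => hp0 e) fun e _ => hp1 e)

end Potential

section Averaging

variable {X : Type*} [DecidableEq X]

lemma sum_offDiag_eq_sum_erase (q : X × X → ℝ) (s : Finset X) :
    ∑ gh ∈ s.offDiag, q gh = ∑ g ∈ s, ∑ h ∈ s.erase g, q (g, h) := by
  rw [Finset.sum_sigma']
  refine Finset.sum_nbij' (fun x => ⟨x.1, x.2⟩) (fun x => (x.1, x.2)) ?_ ?_ ?_ ?_ ?_ <;>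
    simp +contextual [eq_comm]

lemma sum_offDiag_erase (q : X × X → ℝ) {s : Finset X} {v : X} (hv : v ∈ s) :
    ∑ gh ∈ (s.erase v).offDiag, q gh
      = ∑ gh ∈ s.offDiag, q gh - ∑ h ∈ s.erase v, (q (v, h) + q (h, v)) := by
  rw [sum_offDiag_eq_sum_erase, sum_offDiag_eq_sum_erase, ← Finset.add_sum_erase _ _ hv,
    Finset.sum_add_distrib]
  have : ∀ a ∈ s.erase v, ∑ b ∈ s.erase a, q (a, b)
      = q (a, v) + ∑ b ∈ (s.erase v).erase a, q (a, b) := by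
    intro a ha
    rw [Finset.erase_right_comm,
      Finset.add_sum_erase (s.erase a) (fun b => q (a, b))
        (Finset.mem_erase.2 ⟨(Finset.ne_of_mem_erase ha).symm, hv⟩)]
  rw [Finset.sum_congr rfl this, Finset.sum_add_distrib]
  ring

/-- Some vertex lies on at least an average share of the total pair weight. -/
lemma exists_erase_sum_offDiag_le (q : X × X → ℝ) (hq : ∀ gh, 0 ≤ q gh) {s : Finset X}
    (hs : s.Nonempty) :
    ∃ v ∈ s, ∑ gh ∈ (s.erase v).offDiag, q gh
      ≤ (((s.card : ℝ) - 1) / s.card) ^ 2 * ∑ gh ∈ s.offDiag, q gh := by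
  have hm : (0 : ℝ) < s.card := by exact_mod_cast hs.card_pos
  have hdeg : ∑ v ∈ s, ∑ h ∈ s.erase v, (q (v, h) + q (h, v))
      = 2 * ∑ gh ∈ s.offDiag, q gh := by
    have h2 : ∑ gh ∈ s.offDiag, q gh.swap = ∑ gh ∈ s.offDiag, q gh := by
      refine Finset.sum_nbij' Prod.swap Prod.swap ?_ ?_ ?_ ?_ ?_ <;>
        simp +contextual [eq_comm]
    have := (sum_offDiag_eq_sum_erase (fun gh => q gh + q gh.swap) s).symm
    simp only [Prod.swap_prod_mk] at this
    rw [this, Finset.sum_add_distrib, h2]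
    ring
  set Q := ∑ gh ∈ s.offDiag, q gh with hQ
  have hQ0 : 0 ≤ Q := Finset.sum_nonneg fun gh _ => hq gh
  obtain ⟨v, hv, hle⟩ := Finset.exists_le_of_sum_le (s := s) (f := fun _ => 2 * Q / s.card)
    (g := fun v => ∑ h ∈ s.erase v, (q (v, h) + q (h, v))) hs (by
      rw [hdeg, Finset.sum_const, nsmul_eq_mul]
      field_simp
      rfl)
  refine ⟨v, hv, ?_⟩
  rw [sum_offDiag_erase q hv, ← hQ]
  have : (((s.card : ℝ) - 1) / s.card) ^ 2 * Q = Q - 2 * Q / s.card + Q / s.card ^ 2 := by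
    field_simp
    ring
  rw [this]
  have : 0 ≤ Q / (s.card : ℝ) ^ 2 := by positivity
  linarith

lemma exists_subset_sum_offDiag_le (q : X × X → ℝ) (hq : ∀ gh, 0 ≤ q gh) {b : ℕ} (hb : 1 ≤ b)
    (s : Finset X) (hs : b ≤ s.card) :
    ∃ B ⊆ s, B.card = b ∧ ∑ gh ∈ B.offDiag, q gh
      ≤ ((b : ℝ) / s.card) ^ 2 * ∑ gh ∈ s.offDiag, q gh := by
  induction hn : s.card - b generalizing s with
  | zero =>
    have hsb : s.card = b := by omega
    refine ⟨s, subset_rfl, hsb, ?_⟩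
    rw [hsb, div_self (by positivity)]
    simp
  | succ n ih =>
    obtain ⟨v, hv, hle⟩ := exists_erase_sum_offDiag_le q hq (s := s) (Finset.card_pos.1 (by omega))
    have hc : (s.erase v).card = s.card - 1 := Finset.card_erase_of_mem hv
    obtain ⟨B, hB, hBc, hBle⟩ := ih (s.erase v) (by omega) (by omega)
    refine ⟨B, hB.trans (Finset.erase_subset _ _), hBc, hBle.trans ?_⟩
    have hcr : ((s.erase v).card : ℝ) = s.card - 1 := by
      rw [hc, Nat.cast_sub (by omega), Nat.cast_one]
    have h1 : (0 : ℝ) < (s.card : ℝ) - 1 := by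
      have : (1 : ℝ) < s.card := by exact_mod_cast (by omega : 1 < s.card)
      linarith
    refine (mul_le_mul_of_nonneg_left hle (sq_nonneg _)).trans (le_of_eq ?_)
    rw [hcr]
    have : (s.card : ℝ) ≠ 0 := by linarith
    field_simp

end Averaging

section Selection

variable {X : Type*} [DecidableEq X]

/-- Among many elements of small average value one finds `b` elements whose values are close to
each other and whose total pair weight is small. -/
lemma exists_balanced_subset {b k : ℕ} {s W : ℝ} (hb : 1 ≤ b) (hs3 : 3 ≤ s) (hsk : s ^ 3 = k)
    (hW : 0 < W) {V : Finset X} {d : X → ℝ} {q : X × X → ℝ} (hd : ∀ g ∈ V, 0 < d g)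
    (hq : ∀ gh, 0 ≤ q gh) (hdW : ∑ g ∈ V, d g ≤ W * b)
    (hqW : ∑ gh ∈ V.offDiag, q gh ≤ 2 * W) (hV : k * b ≤ V.card) :
    ∃ B ⊆ V, B.card = b ∧ (∀ g ∈ B, ∀ h ∈ B, d h ≤ d g + 2 * W / s ^ 4) ∧
      ∑ gh ∈ B.offDiag, q gh ≤ 32 * W / s ^ 4 := by
  have hbR : (0 : ℝ) < b := by exact_mod_cast hb
  have hs0 : 0 < s := by linarith
  have hk0 : (0 : ℝ) < k := by rw [← hsk]; positivity
  have hVR : (k : ℝ) * b ≤ V.card := by exact_mod_cast hV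
  set L : ℕ := ⌈s⌉₊ with hL
  have hsL : s ≤ L := Nat.le_ceil s
  have hLs : (L : ℝ) + 1 ≤ 2 * s := by
    have := Nat.ceil_lt_add_one hs0.le
    rw [← hL] at this
    linarith
  have hL0 : (0 : ℝ) < L := by linarith
  set A₀ : Finset X := V.filter fun g => d g ≤ 2 * W / k with hA₀
  have hA₀card : (k : ℝ) * b / 2 ≤ A₀.card := by
    have h1 : (A₀.card : ℝ) + (V.filter fun g => ¬ d g ≤ 2 * W / k).card = V.card := by
      exact_mod_cast Finset.card_filter_add_card_filter_not (s := V) fun g => d g ≤ 2 * W / k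
    have h2 : ((V.filter fun g => ¬ d g ≤ 2 * W / k).card : ℝ) * (2 * W / k) ≤ W * b := by
      rw [← nsmul_eq_mul]
      refine (Finset.card_nsmul_le_sum _ d _ fun g hg => ?_).trans
        ((Finset.sum_le_sum_of_subset_of_nonneg (Finset.filter_subset _ _)
          fun g hg _ => (hd g hg).le).trans hdW)
      exact (not_le.1 (Finset.mem_filter.1 hg).2).le
    have h3 : ((V.filter fun g => ¬ d g ≤ 2 * W / k).card : ℝ) ≤ k * b / 2 := by
      rw [mul_div_assoc', div_le_iff₀ hk0] at h2
      nlinarith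
    linarith
  set bucket : X → ℕ := fun g => ⌊d g * (k * L / (2 * W))⌋₊ with hbucket
  have hmaps : ∀ g ∈ A₀, bucket g ∈ Finset.range (L + 1) := by
    intro g hg
    obtain ⟨hgV, hgd⟩ := Finset.mem_filter.1 hg
    rw [Finset.mem_range, Nat.lt_succ_iff]
    apply Nat.floor_le_of_le
    calc d g * (k * L / (2 * W)) ≤ 2 * W / k * (k * L / (2 * W)) := by gcongr
      _ = L := by field_simp
  obtain ⟨y, -, hy⟩ := Finset.exists_le_card_fiber_of_nsmul_le_card_of_maps_to
    (M := ℝ) (b := k * b / 2 / (L + 1)) hmaps ⟨0, by simp⟩ (by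
      rw [Finset.card_range, nsmul_eq_mul]
      push_cast
      rw [mul_div_cancel₀ _ (by positivity)]
      exact hA₀card)
  set A := A₀.filter fun g => bucket g = y with hA
  have hAV : A ⊆ V := (Finset.filter_subset _ _).trans (Finset.filter_subset _ _)
  have hAcard : s ^ 2 / 4 * b ≤ A.card := by
    refine le_trans ?_ hy
    rw [le_div_iff₀ (by positivity), ← hsk]
    have : s ^ 2 / 4 * b * (L + 1) ≤ s ^ 2 / 4 * b * (2 * s) := by gcongr
    nlinarith
  have hbA : b ≤ A.card := by
    have : (1 : ℝ) * b ≤ s ^ 2 / 4 * b := by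
      gcongr
      nlinarith
    exact_mod_cast (one_mul (b : ℝ)) ▸ this.trans hAcard
  obtain ⟨B, hBA, hBc, hBq⟩ := exists_subset_sum_offDiag_le q hq hb A hbA
  refine ⟨B, hBA.trans hAV, hBc, fun g hg h hh => ?_, ?_⟩
  · have hgA := Finset.mem_filter.1 (hBA hg)
    have hhA := Finset.mem_filter.1 (hBA hh)
    have hg0 := hd g (hAV (hBA hg))
    have hfac : 0 < k * L / (2 * W) := by positivity
    have e1 : d h * (k * L / (2 * W)) < y + 1 := by
      rw [← hhA.2]; exact Nat.lt_floor_add_one _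
    have e2 : (y : ℝ) ≤ d g * (k * L / (2 * W)) := by
      rw [← hgA.2]; exact Nat.floor_le (by positivity)
    have e3 : (d h - d g) * (k * L / (2 * W)) ≤ 1 := by linarith
    have e4 : d h - d g ≤ 2 * W / (k * L) := by
      rw [mul_div_assoc', div_le_one (by positivity)] at e3
      rwa [le_div_iff₀ (by positivity)]
    have e5 : 2 * W / (k * L) ≤ 2 * W / s ^ 4 := by
      gcongr
      rw [← hsk, pow_succ]
      gcongr
    linarith
  · have hQ : ∑ gh ∈ A.offDiag, q gh ≤ 2 * W :=
      (Finset.sum_le_sum_of_subset_of_nonneg (Finset.offDiag_mono hAV)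
        fun gh _ _ => hq gh).trans hqW
    have hr : (b : ℝ) / A.card ≤ 4 / s ^ 2 := by
      have hA0 : (0 : ℝ) < A.card := by exact_mod_cast lt_of_lt_of_le hb hbA
      rw [div_le_div_iff₀ hA0 (by positivity)]
      linarith
    calc _ ≤ ((b : ℝ) / A.card) ^ 2 * ∑ gh ∈ A.offDiag, q gh := hBq
      _ ≤ (4 / s ^ 2) ^ 2 * (2 * W) := by
        gcongr
        exact Finset.sum_nonneg fun gh _ => hq gh
      _ = 32 * W / s ^ 4 := by
        field_simp
        norm_num

end Selection

section Copies

variable {X ι I : Type*} [DecidableEq X] [Fintype I]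

/-- The set of elements used by the copy `f`. -/
def copySet (x : ι → I → X) (f : ι) : Finset X := Finset.univ.image (x f)

/-- The set of elements used by a pair of copies. -/
def pairSet (x : ι → I → X) (t : ι × ι) : Finset X := copySet x t.1 ∪ copySet x t.2

open Classical in
/-- The penalty of a pair of copies: `μ` for every pair, and `lam` more if they intersect. -/
noncomputable def pairCoef (x : ι → I → X) (μ lam : ℝ) (t : ι × ι) : ℝ :=
  μ + if Disjoint (copySet x t.1) (copySet x t.2) then 0 else lam

variable {x : ι → I → X} {μ lam : ℝ} {p p' : X → ℝ}

lemma le_pairCoef (hlam : 0 ≤ lam) (t : ι × ι) : μ ≤ pairCoef x μ lam t := by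
  unfold pairCoef
  split_ifs <;> linarith

lemma pairCoef_nonneg (hμ : 0 ≤ μ) (hlam : 0 ≤ lam) (t : ι × ι) : 0 ≤ pairCoef x μ lam t :=
  hμ.trans (le_pairCoef hlam t)

variable [Fintype ι]

/-- Waiter's potential: weighted number of copies minus weighted penalties of pairs of copies. -/
noncomputable def potential (x : ι → I → X) (μ lam : ℝ) (p : X → ℝ) : ℝ :=
  poly (copySet x) (fun _ => 1) p - poly (pairSet x) (pairCoef x μ lam) p

/-- The partial derivative of the potential. -/
noncomputable def potentialDeriv (x : ι → I → X) (μ lam : ℝ) (p : X → ℝ) (g : X) : ℝ :=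
  polyDeriv (copySet x) (fun _ => 1) p g - polyDeriv (pairSet x) (pairCoef x μ lam) p g

lemma mul_sq_poly_copySet_le (hμ : 0 ≤ μ) (hlam : 0 ≤ lam) (hp0 : ∀ e, 0 ≤ p e)
    (hp1 : ∀ e, p e ≤ 1) :
    μ * poly (copySet x) (fun _ => 1) p ^ 2 ≤ poly (pairSet x) (pairCoef x μ lam) p := by
  unfold poly
  rw [sq, Fintype.sum_mul_sum, ← Fintype.sum_prod_type', Finset.mul_sum]
  refine Finset.sum_le_sum fun t _ => ?_
  rw [one_mul, one_mul]
  exact mul_le_mul (le_pairCoef hlam t) (prod_mul_prod_le_prod_union hp0 hp1 _ _)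
    (mul_nonneg (Finset.prod_nonneg fun e _ => hp0 e) (Finset.prod_nonneg fun e _ => hp0 e))
    (pairCoef_nonneg hμ hlam t)

lemma mul_sq_polyDeriv_copySet_le (hμ : 0 ≤ μ) (hlam : 0 ≤ lam) (hp0 : ∀ e, 0 ≤ p e)
    (hp1 : ∀ e, p e ≤ 1) (g : X) :
    lam * polyDeriv (copySet x) (fun _ => 1) p g ^ 2
      ≤ polyDeriv (pairSet x) (pairCoef x μ lam) p g := by
  have hpr : ∀ s : Finset X, 0 ≤ ∏ e ∈ s, p e := fun s => Finset.prod_nonneg fun e _ => hp0 e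
  unfold polyDeriv
  rw [sq, Fintype.sum_mul_sum, ← Fintype.sum_prod_type', Finset.mul_sum]
  refine Finset.sum_le_sum fun t _ => ?_
  have hR : 0 ≤ if g ∈ pairSet x t then
      pairCoef x μ lam t * ∏ e ∈ (pairSet x t).erase g, p e else 0 := by
    split_ifs
    · exact mul_nonneg (pairCoef_nonneg hμ hlam t) (hpr _)
    · rfl
  by_cases h1 : g ∈ copySet x t.1
  · by_cases h2 : g ∈ copySet x t.2
    · have hc : lam ≤ pairCoef x μ lam t := by
        unfold pairCoef
        rw [if_neg fun hd => Finset.disjoint_left.1 hd h1 h2]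
        linarith
      rw [if_pos h1, if_pos h2, if_pos (show g ∈ pairSet x t from Finset.mem_union_left _ h1),
        one_mul, one_mul,
        pairSet, Finset.erase_union_distrib]
      exact mul_le_mul hc (prod_mul_prod_le_prod_union hp0 hp1 _ _)
        (mul_nonneg (hpr _) (hpr _)) (pairCoef_nonneg hμ hlam t)
    · simpa [h2] using hR
  · simpa [h1] using hR

lemma potentialDeriv_le (hμ : 0 ≤ μ) (hlam : 0 < lam) (hp0 : ∀ e, 0 ≤ p e)
    (hp1 : ∀ e, p e ≤ 1) (g : X) : potentialDeriv x μ lam p g ≤ 1 / (4 * lam) := by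
  have h := mul_sq_polyDeriv_copySet_le (x := x) hμ hlam.le hp0 hp1 g
  unfold potentialDeriv
  rw [le_div_iff₀ (by positivity)]
  nlinarith [sq_nonneg (2 * lam * polyDeriv (copySet x) (fun _ => 1) p g - 1)]

lemma poly_copySet_le (hμ : 0 < μ) (hlam : 0 ≤ lam) (hp0 : ∀ e, 0 ≤ p e)
    (hp1 : ∀ e, p e ≤ 1) (hpot : 0 ≤ potential x μ lam p) :
    poly (copySet x) (fun _ => 1) p ≤ 1 / μ := by
  have h := mul_sq_poly_copySet_le (x := x) hμ.le hlam hp0 hp1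
  unfold potential at hpot
  rw [le_div_iff₀ hμ]
  by_contra! hlt
  nlinarith

lemma potential_discard {g : X} (hg : p' g = 0) (hp : ∀ e, e ≠ g → p' e = p e) :
    potential x μ lam p' = potential x μ lam p - p g * potentialDeriv x μ lam p g := by
  unfold potential potentialDeriv
  rw [poly_discard hg hp, poly_discard hg hp]
  ring

lemma potential_offer_ge {r : ℝ} {B : Finset X} {g : X} (hμ : 0 ≤ μ) (hlam : 0 ≤ lam)
    (hp0 : ∀ e, 0 ≤ p e) (hr : ∀ h ∈ B, p h = r) (hg : g ∈ B)
    (hg1 : p' g = 1) (hB0 : ∀ h ∈ B, h ≠ g → p' h = 0) (hp : ∀ e ∉ B, p' e = p e)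
    (hA : ∀ f, (copySet x f ∩ B).card ≤ 1) :
    potential x μ lam p + potentialDeriv x μ lam p g
      - r * ∑ h ∈ B, potentialDeriv x μ lam p h
      - ∑ gh ∈ B.offDiag, polyPair (pairSet x) (pairCoef x μ lam) p gh
      ≤ potential x μ lam p' := by
  have h1 := poly_offer_eq (c := fun _ => 1) hr hg hg1 hB0 hp hA
  have h2 := poly_offer_le (A := pairSet x) (pairCoef_nonneg (x := x) hμ hlam) hp0 hr hg hg1
    hB0 hp
  unfold potential potentialDeriv
  rw [Finset.sum_sub_distrib]
  linarith

end Copies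

section Stages

variable {X ι I : Type*} [DecidableEq X]

/-- The weight of the elements in the position `(S, U)`: chosen elements have weight `1`,
available elements have weight `1 / b`, and all other elements have weight `0`. -/
noncomputable def weight (b : ℕ) (S U : Finset X) (e : X) : ℝ :=
  if e ∈ U then (b : ℝ)⁻¹ else if e ∈ S then 1 else 0

lemma weight_nonneg (b : ℕ) (S U : Finset X) (e : X) : 0 ≤ weight b S U e := by
  unfold weight
  split_ifs <;> positivity

lemma weight_le_one {b : ℕ} (hb : 1 ≤ b) (S U : Finset X) (e : X) : weight b S U e ≤ 1 := by
  unfold weight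
  split_ifs
  · exact inv_le_one_of_one_le₀ (by exact_mod_cast hb)
  · rfl
  · exact zero_le_one

/-- The loss in potential caused by one round with about `k * b` available elements. -/
noncomputable def roundLoss (k : ℕ) : ℝ := 34 * (k : ℝ) ^ (-(4 / 3) : ℝ)

lemma roundLoss_nonneg (k : ℕ) : 0 ≤ roundLoss k := by
  unfold roundLoss
  positivity

/-- An upper bound on the loss in potential during the rest of a stage with `M` available
elements left. -/
noncomputable def stageLoss (μ lam : ℝ) (b k₀ M : ℕ) : ℝ :=
  1 / (4 * lam) * ((min M (k₀ * b) : ℕ) / b) + ∑ k ∈ Finset.Ico k₀ (M / b + 1), roundLoss k / μ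

lemma stageLoss_mono {μ lam : ℝ} (hμ : 0 < μ) (hlam : 0 < lam) (b k₀ : ℕ) :
    Monotone (stageLoss μ lam b k₀) := by
  intro M M' h
  unfold stageLoss
  gcongr
  exact fun _ _ _ => div_nonneg (roundLoss_nonneg _) hμ.le

lemma stageLoss_nonneg {μ lam : ℝ} (hμ : 0 < μ) (hlam : 0 < lam) (b k₀ M : ℕ) :
    0 ≤ stageLoss μ lam b k₀ M :=
  add_nonneg (by positivity)
    (Finset.sum_nonneg fun _ _ => div_nonneg (roundLoss_nonneg _) hμ.le)

lemma stageLoss_pred {μ lam : ℝ} (hμ : 0 < μ) {b k₀ M : ℕ} (hM0 : 1 ≤ M)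
    (hM : M ≤ k₀ * b) :
    stageLoss μ lam b k₀ (M - 1) + (b : ℝ)⁻¹ * (1 / (4 * lam)) ≤ stageLoss μ lam b k₀ M := by
  unfold stageLoss
  rw [min_eq_left hM, min_eq_left ((Nat.sub_le _ _).trans hM), Nat.cast_sub hM0, Nat.cast_one]
  have : ∑ k ∈ Finset.Ico k₀ ((M - 1) / b + 1), roundLoss k / μ
      ≤ ∑ k ∈ Finset.Ico k₀ (M / b + 1), roundLoss k / μ := by
    apply Finset.sum_le_sum_of_subset_of_nonneg
    · gcongr
      omega
    · exact fun _ _ _ => div_nonneg (roundLoss_nonneg _) hμ.le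
  have e : 1 / (4 * lam) * (((M : ℝ) - 1) / b) + (b : ℝ)⁻¹ * (1 / (4 * lam))
      = 1 / (4 * lam) * ((M : ℝ) / b) := by ring
  linarith

lemma stageLoss_sub {μ lam : ℝ} (hlam : 0 < lam) {b k₀ M : ℕ} (hb : 1 ≤ b)
    (hk₀ : 1 ≤ k₀) (hM : k₀ ≤ M / b) :
    stageLoss μ lam b k₀ (M - b) + roundLoss (M / b) / μ ≤ stageLoss μ lam b k₀ M := by
  unfold stageLoss
  have h1 : (M - b) / b + 1 = M / b :=
    (Nat.div_eq_sub_div hb ((Nat.div_pos_iff.1 (hk₀.trans hM)).2)).symm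
  rw [h1, Finset.sum_Ico_succ_top hM]
  have h2 : 1 / (4 * lam) * ((min (M - b) (k₀ * b) : ℕ) / (b : ℝ))
      ≤ 1 / (4 * lam) * ((min M (k₀ * b) : ℕ) / (b : ℝ)) := by
    gcongr
    omega
  linarith

variable [Fintype I] {x : ι → I → X} {μ lam : ℝ}

lemma card_pairSet_inter_le {V : Finset X} (hV : ∀ f, (copySet x f ∩ V).card ≤ 1)
    (t : ι × ι) : (pairSet x t ∩ V).card ≤ 2 := by
  unfold pairSet
  rw [Finset.union_inter_distrib_right]
  exact (Finset.card_union_le _ _).trans (Nat.add_le_add (hV t.1) (hV t.2))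

variable [Fintype ι]

/-- One round: Waiter has an offer costing little potential, whatever Client chooses. -/
lemma exists_offer {b k : ℕ} (hb : 1 ≤ b) (hμ : 0 < μ) (hlam : 0 < lam) (hk : 27 ≤ k)
    {S U V : Finset X} (hSU : Disjoint S U) (hVU : V ⊆ U)
    (hV : ∀ f, (copySet x f ∩ V).card ≤ 1) (hkV : k * b ≤ V.card)
    (hpot : 0 ≤ potential x μ lam (weight b S U))
    (hpos : ∀ g ∈ V, 0 < potentialDeriv x μ lam (weight b S U) g) :
    ∃ B ⊆ V, B.card = b ∧ ∀ g ∈ B, potential x μ lam (weight b S U) - roundLoss k / μ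
      ≤ potential x μ lam (weight b (insert g S) (U \ B)) := by
  set p := weight b S U with hp
  have hp0 : ∀ e, 0 ≤ p e := weight_nonneg b S U
  have hp1 : ∀ e, p e ≤ 1 := weight_le_one hb S U
  have hbR : (0 : ℝ) < b := by exact_mod_cast hb
  have hpV : ∀ h ∈ V, p h = (b : ℝ)⁻¹ := fun h hh => if_pos (hVU hh)
  have hc0 := pairCoef_nonneg (x := x) hμ.le hlam.le
  have hpr : ∀ s : Finset X, 0 ≤ ∏ e ∈ s, p e := fun s => Finset.prod_nonneg fun e _ => hp0 e
  have hPos := poly_copySet_le hμ hlam.le hp0 hp1 hpot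
  set s : ℝ := (k : ℝ) ^ (1 / 3 : ℝ) with hs
  have hsk : s ^ 3 = k := by
    rw [hs, ← Real.rpow_natCast, ← Real.rpow_mul (by positivity)]
    norm_num
  have hs3 : 3 ≤ s := by
    have h27 : (27 : ℝ) ≤ s ^ 3 := by rw [hsk]; exact_mod_cast hk
    by_contra! hlt
    have hs0 : 0 ≤ s := by positivity
    have : s ^ 3 < 3 ^ 3 := by gcongr
    linarith
  have hs4 : 34 * (1 / μ) / s ^ 4 = roundLoss k / μ := by
    have : (k : ℝ) ^ (-(4 / 3) : ℝ) = (s ^ 4)⁻¹ := by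
      rw [Real.rpow_neg (by positivity), hs, ← Real.rpow_natCast,
        ← Real.rpow_mul (by positivity)]
      norm_num
    unfold roundLoss
    rw [this]
    ring
  have hsum : ∑ g ∈ V, potentialDeriv x μ lam p g ≤ 1 / μ * b := by
    have h1 : ∑ g ∈ V, potentialDeriv x μ lam p g
        ≤ ∑ g ∈ V, polyDeriv (copySet x) (fun _ => 1) p g :=
      Finset.sum_le_sum fun g _ => sub_le_self _ (polyDeriv_nonneg hc0 hp0 g)
    have h2 : (b : ℝ)⁻¹ * ∑ g ∈ V, polyDeriv (copySet x) (fun _ => 1) p g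
        ≤ poly (copySet x) (fun _ => 1) p := by
      rw [mul_sum_polyDeriv hpV]
      refine Finset.sum_le_sum fun f _ => ?_
      gcongr
      exact mul_le_of_le_one_left (hpr _) (by exact_mod_cast hV f)
    rw [inv_mul_le_iff₀ hbR] at h2
    calc _ ≤ (b : ℝ) * poly (copySet x) (fun _ => 1) p := h1.trans h2
      _ ≤ b * (1 / μ) := by gcongr
      _ = _ := mul_comm _ _
  have hpair : ∑ gh ∈ V.offDiag, polyPair (pairSet x) (pairCoef x μ lam) p gh
      ≤ 2 * (1 / μ) := by
    have h1 : ∑ gh ∈ V.offDiag, polyPair (pairSet x) (pairCoef x μ lam) p gh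
        ≤ 2 * poly (pairSet x) (pairCoef x μ lam) p := by
      rw [sum_polyPair, poly, Finset.mul_sum]
      refine Finset.sum_le_sum fun t _ => ?_
      rw [mul_left_comm 2]
      refine mul_le_mul_of_nonneg_left (mul_le_mul_of_nonneg_right ?_ (hpr _)) (hc0 t)
      have : ((pairSet x t ∩ V).card : ℝ) ≤ 2 := by exact_mod_cast card_pairSet_inter_le hV t
      have : (0 : ℝ) ≤ (pairSet x t ∩ V).card := Nat.cast_nonneg _
      nlinarith
    unfold potential at hpot
    linarith
  obtain ⟨B, hBV, hBc, hBd, hBq⟩ := exists_balanced_subset hb hs3 hsk (W := 1 / μ)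
    (by positivity) hpos (polyPair_nonneg hc0 hp0) hsum hpair hkV
  refine ⟨B, hBV, hBc, fun g hg => ?_⟩
  have hBU := hBV.trans hVU
  have hoff := potential_offer_ge (x := x) (μ := μ) (lam := lam) (p := p)
    (p' := weight b (insert g S) (U \ B)) hμ.le hlam.le hp0 (fun h hh => hpV h (hBV hh)) hg
    (by simp [weight, hg])
    (fun h hh hne => by
      have : h ∉ S := fun hS => Finset.disjoint_left.1 hSU hS (hBU hh)
      simp [weight, hh, hne, this])
    (fun e he => by
      have : e ≠ g := by rintro rfl; exact he hg
      simp [hp, weight, he, this])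
    (fun f => (Finset.card_le_card (Finset.inter_subset_inter_left hBV)).trans (hV f))
  have havg : (b : ℝ)⁻¹ * ∑ h ∈ B, potentialDeriv x μ lam p h
      ≤ potentialDeriv x μ lam p g + 2 * (1 / μ) / s ^ 4 := by
    rw [inv_mul_le_iff₀ hbR]
    have := Finset.sum_le_card_nsmul B _ _ (hBd g hg)
    rwa [hBc, nsmul_eq_mul] at this
  have : 2 * (1 / μ) / s ^ 4 + 32 * (1 / μ) / s ^ 4 = roundLoss k / μ := by
    rw [← hs4]
    ring
  linarith

lemma potential_erase {b : ℕ} {S U : Finset X} (hSU : Disjoint S U) {g : X} (hg : g ∈ U) :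
    potential x μ lam (weight b S (U.erase g)) = potential x μ lam (weight b S U)
      - (b : ℝ)⁻¹ * potentialDeriv x μ lam (weight b S U) g := by
  have hgS : g ∉ S := fun h => Finset.disjoint_left.1 hSU h hg
  rw [potential_discard (p := weight b S U) (g := g)]
  · simp [weight, hg]
  · simp [weight, hgS]
  · intro e he
    simp [weight, he]

/-- A stage: Waiter exhausts the available elements of `V` at bounded cost in potential. -/
lemma waiterWins_of_stage {b k₀ : ℕ} (hb : 1 ≤ b) (hμ : 0 < μ) (hlam : 0 < lam) (hk₀ : 27 ≤ k₀)
    {P : Finset X → Prop} {τ : ℝ} (hτ : 0 ≤ τ) {U₀ V : Finset X}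
    (hV : ∀ f, (copySet x f ∩ V).card ≤ 1)
    (hwin : ∀ S U, Disjoint S U → U ⊆ U₀ \ V → τ ≤ potential x μ lam (weight b S U) →
      WaiterWins b P S U)
    (M : ℕ) (S U : Finset X) (hM : (U ∩ V).card = M) (hU : U ⊆ U₀) (hSU : Disjoint S U)
    (hpot : τ + stageLoss μ lam b k₀ M ≤ potential x μ lam (weight b S U)) :
    WaiterWins b P S U := by
  induction M using Nat.strong_induction_on generalizing S U with
  | _ M ih =>
    have hM0 := stageLoss_nonneg hμ hlam b k₀ M
    rcases Nat.eq_zero_or_pos M with h0 | hMpos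
    · refine hwin S U hSU (Finset.subset_sdiff.2 ⟨hU, ?_⟩) (by linarith)
      exact Finset.disjoint_iff_inter_eq_empty.2 (Finset.card_eq_zero.1 (hM.trans h0))
    have herase : ∀ g ∈ U ∩ V, τ + stageLoss μ lam b k₀ (M - 1)
        ≤ potential x μ lam (weight b S (U.erase g)) → WaiterWins b P S U := by
      intro g hg hle
      refine (ih (M - 1) (by omega) S (U.erase g) ?_ ((Finset.erase_subset _ _).trans hU)
        (hSU.mono_right (Finset.erase_subset _ _)) hle).mono (Finset.erase_subset _ _)
      rw [Finset.erase_inter, Finset.card_erase_of_mem hg, hM]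
    have hbinv : (0 : ℝ) ≤ (b : ℝ)⁻¹ := by positivity
    by_cases hneg : ∃ g ∈ U ∩ V, potentialDeriv x μ lam (weight b S U) g ≤ 0
    · obtain ⟨g, hg, hle⟩ := hneg
      apply herase g hg
      rw [potential_erase hSU (Finset.mem_inter.1 hg).1]
      have h1 := stageLoss_mono hμ hlam b k₀ (Nat.sub_le M 1)
      have h2 := mul_nonpos_of_nonneg_of_nonpos hbinv hle
      linarith
    push Not at hneg
    by_cases hsmall : M ≤ k₀ * b
    · obtain ⟨g, hg⟩ : (U ∩ V).Nonempty := Finset.card_pos.1 (by omega)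
      apply herase g hg
      rw [potential_erase hSU (Finset.mem_inter.1 hg).1]
      have h1 := stageLoss_pred (lam := lam) hμ hMpos hsmall
      have h2 := mul_le_mul_of_nonneg_left (potentialDeriv_le (x := x) hμ.le hlam
        (weight_nonneg b S U) (weight_le_one hb S U) g) hbinv
      linarith
    · have hk : k₀ ≤ M / b := (Nat.le_div_iff_mul_le hb).2 (by omega)
      obtain ⟨B, hBV, hBc, hB⟩ := exists_offer (x := x) (V := U ∩ V) (k := M / b) hb hμ hlam
        (hk₀.trans hk) hSU Finset.inter_subset_left
        (fun f => (Finset.card_le_card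
          (Finset.inter_subset_inter_left Finset.inter_subset_right)).trans (hV f))
        (by rw [hM]; exact Nat.div_mul_le_self M b) (by linarith) hneg
      have hBU : B ⊆ U := hBV.trans Finset.inter_subset_left
      refine .offer B hBU hBc fun g hg => ih (M - b) (by omega) _ _ ?_
        (Finset.sdiff_subset.trans hU) ?_ ?_
      · rw [Finset.sdiff_inter_right_comm, Finset.card_sdiff_of_subset hBV, hM, hBc]
      · rw [Finset.disjoint_insert_left]
        exact ⟨fun h => (Finset.mem_sdiff.1 h).2 hg, hSU.mono_right Finset.sdiff_subset⟩
      · have h1 := stageLoss_sub (μ := μ) hlam hb (by omega) hk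
        have h2 := hB g hg
        linarith

end Stages

section Abstract

variable {X ι I : Type*} [DecidableEq X] [Fintype I] {x : ι → I → X}

lemma card_copySet (hx : ∀ f f' i i', x f i = x f' i' → i = i') (f : ι) :
    (copySet x f).card = Fintype.card I := by
  rw [copySet, Finset.card_image_of_injective _ fun i i' h => hx f f i i' h, Finset.card_univ]

variable [Fintype ι]

/-- The elements playing the role `i` in some copy. -/
def roleSet (x : ι → I → X) (i : I) : Finset X := Finset.univ.image fun f => x f i

lemma card_copySet_inter_roleSet_le (hx : ∀ f f' i i', x f i = x f' i' → i = i') (i : I) (f : ι) :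
    (copySet x f ∩ roleSet x i).card ≤ 1 := by
  have : copySet x f ∩ roleSet x i ⊆ {x f i} := by
    intro e he
    simp only [copySet, roleSet, Finset.mem_inter, Finset.mem_image, Finset.mem_univ,
      true_and] at he
    obtain ⟨⟨i', rfl⟩, f', h⟩ := he
    rw [hx f' f i i' h]
    simp
  simpa using Finset.card_le_card this

lemma exists_sum_roundLoss_le {ε : ℝ} (hε : 0 < ε) :
    ∃ k₀ : ℕ, 27 ≤ k₀ ∧ ∀ K, ∑ k ∈ Finset.Ico k₀ K, roundLoss k ≤ ε := by
  have hs : Summable roundLoss :=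
    (Real.summable_nat_rpow.2 (by norm_num : (-(4 / 3) : ℝ) < -1)).mul_left 34
  have ht := (tendsto_sum_nat_add roundLoss).eventually (gt_mem_nhds hε)
  obtain ⟨k₀, h1, h2⟩ := (ht.and (Filter.eventually_ge_atTop 27)).exists
  refine ⟨k₀, h2, fun K => ?_⟩
  rw [Finset.sum_Ico_eq_sum_range]
  refine le_trans ?_ h1.le
  simp_rw [add_comm k₀]
  exact ((summable_nat_add_iff k₀).2 hs).sum_le_tsum _ fun i _ => roundLoss_nonneg _

lemma stageLoss_le {μ lam ε : ℝ} (hμ : 0 < μ) (hlam : 0 < lam) {b k₀ : ℕ} (hb : 1 ≤ b)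
    (hε : ∀ K, ∑ k ∈ Finset.Ico k₀ K, roundLoss k ≤ ε) (M : ℕ) :
    stageLoss μ lam b k₀ M ≤ 1 / (4 * lam) * k₀ + ε / μ := by
  unfold stageLoss
  rw [← Finset.sum_div]
  have hbR : (0 : ℝ) < b := by exact_mod_cast hb
  gcongr
  · rw [div_le_iff₀ hbR]
    exact_mod_cast min_le_right _ _
  · exact hε _

lemma prod_weight_empty (b : ℕ) {U s : Finset X} (hs : s ⊆ U) :
    ∏ e ∈ s, weight b ∅ U e = ((b : ℝ)⁻¹) ^ s.card := by
  have : ∀ e ∈ s, weight b ∅ U e = (b : ℝ)⁻¹ := fun e he => if_pos (hs he)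
  rw [Finset.prod_congr rfl this, Finset.prod_const]

open Classical in
lemma poly_weight_of_finished (b : ℕ) (S : Finset X) :
    poly (copySet x) (fun _ => 1) (weight b S ∅)
      = ((Finset.univ.filter fun f => copySet x f ⊆ S).card : ℝ) := by
  unfold poly
  rw [Finset.card_filter]
  push_cast
  refine Finset.sum_congr rfl fun f _ => ?_
  rw [one_mul]
  split_ifs with h
  · exact Finset.prod_eq_one fun e he => by simp [weight, h he]
  · obtain ⟨e, he, heS⟩ := Finset.not_subset.1 h
    exact Finset.prod_eq_zero he (by simp [weight, heS])

open Classical in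
/-- The stages are played one role after the other. -/
lemma waiterWins_of_roles {b k₀ : ℕ} {μ lam η N : ℝ} (hb : 1 ≤ b) (hμ : 0 < μ) (hlam : 0 < lam)
    (hk₀ : 27 ≤ k₀) (hη0 : 0 ≤ η) (hη : ∀ M, stageLoss μ lam b k₀ M ≤ η) (hN : 0 ≤ N)
    (hx : ∀ f f' i i', x f i = x f' i' → i = i') (T : Finset I) (S U : Finset X)
    (hU : U ⊆ T.biUnion (roleSet x)) (hSU : Disjoint S U)
    (hpot : N + T.card * η ≤ potential x μ lam (weight b S U)) :
    WaiterWins b (fun S => N ≤ ((Finset.univ.filter fun f => copySet x f ⊆ S).card : ℝ)) S U := by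
  induction T using Finset.induction_on generalizing S U with
  | empty =>
    have hU0 : U = ∅ := by simpa using hU
    subst hU0
    refine .finish ?_
    rw [← poly_weight_of_finished b S]
    have h0 : 0 ≤ poly (pairSet x) (pairCoef x μ lam) (weight b S ∅) :=
      Finset.sum_nonneg fun t _ => mul_nonneg (pairCoef_nonneg hμ.le hlam.le t)
        (Finset.prod_nonneg fun e _ => weight_nonneg b S ∅ e)
    unfold potential at hpot
    simp only [Finset.card_empty, Nat.cast_zero, zero_mul, add_zero] at hpot
    linarith
  | insert i T hi ih =>
    rw [Finset.card_insert_of_notMem hi] at hpot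
    push_cast at hpot
    refine waiterWins_of_stage hb hμ hlam hk₀ (τ := N + T.card * η) (by positivity)
      (U₀ := (insert i T).biUnion (roleSet x)) (V := roleSet x i)
      (card_copySet_inter_roleSet_le hx i) (fun S' U' hd hsub hle => ih S' U' ?_ hd hle)
      _ S U rfl hU hSU ?_
    · refine hsub.trans ?_
      rw [Finset.biUnion_insert, Finset.union_sdiff_left]
      exact Finset.sdiff_subset
    · have := hη (U ∩ roleSet x i).card
      linarith

open Classical in
/-- If the expected number `N` of copies in a random set of density `1 / b` satisfies a second
moment condition, then Waiter can ensure at least `N / 4` copies. -/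
theorem waiterWins_of_second_moment {b k₀ : ℕ} {N δ : ℝ} (hb : 1 ≤ b) (hk₀ : 27 ≤ k₀)
    (hsum : ∀ K, ∑ k ∈ Finset.Ico k₀ K, roundLoss k ≤ 1 / (64 * (Fintype.card I + 1)))
    (hδ0 : 0 < δ) (hδ : δ ≤ 1 / (16 * k₀ * (Fintype.card I + 1)))
    (hx : ∀ f f' i i', x f i = x f' i' → i = i') (hN : 0 < N)
    (hNcard : N = Fintype.card ι * ((b : ℝ)⁻¹) ^ Fintype.card I)
    (hpairs : ∑ t : ι × ι, (if Disjoint (copySet x t.1) (copySet x t.2) then 0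
      else ((b : ℝ)⁻¹) ^ (pairSet x t).card) ≤ δ * N ^ 2) :
    WaiterWins b (fun S => N / 4 ≤ ((Finset.univ.filter fun f => copySet x f ⊆ S).card : ℝ))
      ∅ (Finset.univ.biUnion (roleSet x)) := by
  set m := Fintype.card I with hm
  set U := Finset.univ.biUnion (roleSet x) with hU
  have hk₀R : (27 : ℝ) ≤ k₀ := by exact_mod_cast hk₀
  have hm0 : (0 : ℝ) ≤ m := Nat.cast_nonneg _
  have hδ1 : δ ≤ 1 := by
    refine hδ.trans ((div_le_one (by positivity)).2 ?_)
    nlinarith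
  have hfU : ∀ f, copySet x f ⊆ U := by
    intro f e he
    obtain ⟨i, -, rfl⟩ := Finset.mem_image.1 he
    exact Finset.mem_biUnion.2 ⟨i, Finset.mem_univ _,
      Finset.mem_image.2 ⟨f, Finset.mem_univ _, rfl⟩⟩
  have hw : ∀ f, ∏ e ∈ copySet x f, weight b ∅ U e = ((b : ℝ)⁻¹) ^ m := fun f => by
    rw [prod_weight_empty b (hfU f), card_copySet hx]
  have hpos : poly (copySet x) (fun _ => 1) (weight b ∅ U) = N := by
    unfold poly
    simp only [hw, one_mul, Finset.sum_const, Finset.card_univ, nsmul_eq_mul]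
    exact hNcard.symm
  set μ : ℝ := 1 / (8 * N) with hμd
  set lam : ℝ := 1 / (8 * δ * N) with hlamd
  have hμ : 0 < μ := by positivity
  have hlam : 0 < lam := by positivity
  have hneg : poly (pairSet x) (pairCoef x μ lam) (weight b ∅ U)
      ≤ μ * N ^ 2 + (μ + lam) * (δ * N ^ 2) := by
    refine le_trans ?_ (add_le_add_right (mul_le_mul_of_nonneg_left hpairs (by positivity)) _)
    rw [← hpos]
    unfold poly
    rw [sq, Fintype.sum_mul_sum, ← Fintype.sum_prod_type', Finset.mul_sum, Finset.mul_sum,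
      ← Finset.sum_add_distrib]
    refine Finset.sum_le_sum fun t _ => ?_
    unfold pairCoef
    split_ifs with hd
    · rw [pairSet, Finset.prod_union hd]
      simp
    · have hsub : pairSet x t ⊆ U := Finset.union_subset (hfU _) (hfU _)
      rw [prod_weight_empty b hsub, hw, hw]
      have : 0 ≤ μ * (1 * ((b : ℝ)⁻¹) ^ m * (1 * ((b : ℝ)⁻¹) ^ m)) := by positivity
      linarith
  have hpot : N / 2 ≤ potential x μ lam (weight b ∅ U) := by
    unfold potential
    rw [hpos]
    have e : μ * N ^ 2 + (μ + lam) * (δ * N ^ 2) = N / 8 + δ * N / 8 + N / 8 := by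
      rw [hμd, hlamd]
      field_simp
      ring
    nlinarith
  refine waiterWins_of_roles (η := N / (4 * (m + 1))) hb hμ hlam hk₀ (by positivity)
    (fun M => (stageLoss_le hμ hlam hb hsum M).trans ?_) (by positivity) hx Finset.univ ∅ U
    subset_rfl (Finset.disjoint_empty_left _) (le_trans ?_ hpot)
  · have h1 : 1 / (4 * lam) * k₀ ≤ N / (8 * (m + 1)) := by
      have : 1 / (4 * lam) * k₀ = 2 * k₀ * N * δ := by
        rw [hlamd]
        field_simp
        norm_num
      rw [this]
      calc 2 * k₀ * N * δ ≤ 2 * k₀ * N * (1 / (16 * k₀ * (m + 1))) := by gcongr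
        _ = N / (8 * (m + 1)) := by
          field_simp
          norm_num
    have h2 : 1 / (64 * ((m : ℝ) + 1)) / μ = N / (8 * (m + 1)) := by
      rw [hμd]
      field_simp
      norm_num
    have h3 : N / (8 * ((m : ℝ) + 1)) + N / (8 * (m + 1)) = N / (4 * (m + 1)) := by
      field_simp
      norm_num
    linarith
  · rw [Finset.card_univ, ← hm]
    have : (m : ℝ) * (N / (4 * (m + 1))) ≤ N / 4 := by
      rw [mul_div_assoc', div_le_div_iff₀ (by positivity) (by positivity)]
      nlinarith
    linarith

end Abstract

end WCGame

namespace GraphDefs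

section PartiteCopies

variable {α β : Type*} {H : SimpleGraph α} {q : ℕ}

/-- The edge `i` of the canonical copy of `H` whose vertex in the part of `a` is `φ (a, f a)`. -/
def partiteEdge (H : SimpleGraph α) (φ : α × Fin q ↪ β) (f : α → Fin q) (i : H.edgeSet) :
    Sym2 β :=
  Sym2.map (fun a => φ (a, f a)) i

lemma eq_and_agree_of_partiteEdge_eq {φ : α × Fin q ↪ β} {f f' : α → Fin q} {i i' : H.edgeSet}
    (h : partiteEdge H φ f i = partiteEdge H φ f' i') :
    i = i' ∧ ∀ a ∈ (i : Sym2 α), f a = f' a := by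
  have h1 : Sym2.map (fun a => (a, f a)) (i : Sym2 α) = Sym2.map (fun a => (a, f' a)) i' := by
    apply Sym2.map.injective φ.injective
    simpa [partiteEdge, Sym2.map_map, Function.comp_def] using h
  refine ⟨?_, fun a ha => ?_⟩
  · have h2 := congrArg (Sym2.map Prod.fst) h1
    simpa [Sym2.map_map, Function.comp_def, Subtype.ext_iff] using h2
  · have h2 : (a, f a) ∈ Sym2.map (fun a => (a, f' a)) (i' : Sym2 α) :=
      h1 ▸ Sym2.mem_map.2 ⟨a, ha, rfl⟩
    obtain ⟨a', -, h3⟩ := Sym2.mem_map.1 h2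
    obtain ⟨rfl, h4⟩ := Prod.mk.injEq .. ▸ h3
    exact h4.symm

lemma partiteEdge_role_injective {φ : α × Fin q ↪ β} (f f' : α → Fin q)
    (i i' : H.edgeSet)
    (h : partiteEdge H φ f i = partiteEdge H φ f' i') : i = i' :=
  (eq_and_agree_of_partiteEdge_eq h).1

lemma ncard_edgeSet_induce (H : SimpleGraph α) (s : Set α) :
    ((⊤ : H.Subgraph).induce s).edgeSet.ncard = eIn H s := by
  unfold eIn
  congr 1
  ext e
  induction e with
  | _ a b => simp [and_comm, and_assoc]

lemma eIn_univ (H : SimpleGraph α) : eIn H Set.univ = H.edgeSet.ncard := by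
  simp [eIn]

variable [Fintype α]

lemma eIn_le_maxDensity_mul (H : SimpleGraph α) {s : Set α} (hs : s.Nonempty) :
    (eIn H s : ℝ) ≤ maxDensity H * s.ncard := by
  have hpos : (0 : ℝ) < s.ncard := by exact_mod_cast (Set.ncard_pos).2 hs
  rw [← div_le_iff₀ hpos]
  refine le_csSup (Set.Finite.bddAbove ?_) ⟨(⊤ : H.Subgraph).induce s, hs, ?_⟩
  · refine (Set.finite_range fun H' : H.Subgraph =>
      (H'.edgeSet.ncard : ℝ) / (H'.verts.ncard : ℝ)).subset ?_
    rintro d ⟨H', -, rfl⟩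
    exact ⟨H', rfl⟩
  · rw [ncard_edgeSet_induce]
    rfl

lemma nonempty_of_eIn_pos {s : Set α} (h : 0 < eIn H s) : s.Nonempty := by
  obtain ⟨e, -, he⟩ := (Set.ncard_pos).1 h
  induction e with
  | _ a b => exact ⟨a, he a (Sym2.mem_mk_left a b)⟩

lemma maxDensity_pos (hH : H.edgeSet.Nonempty) : 0 < maxDensity H := by
  have h1 : 0 < eIn H Set.univ := by rw [eIn_univ]; exact (Set.ncard_pos).2 hH
  have h2 := eIn_le_maxDensity_mul H (nonempty_of_eIn_pos h1)
  have h3 : (0 : ℝ) < eIn H Set.univ := by exact_mod_cast h1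
  by_contra! h
  exact absurd (h3.trans_le h2)
    (not_lt.2 (mul_nonpos_of_nonpos_of_nonneg h (Nat.cast_nonneg _)))

lemma sum_pow_card_agree (α : Type*) [Fintype α] [DecidableEq α] (q : ℕ) :
    ∑ t : (α → Fin q) × (α → Fin q), (q : ℝ) ^ ({a | t.1 a = t.2 a} : Set α).ncard
      ≤ (2 * (q : ℝ) ^ 2) ^ Fintype.card α := by
  have h1 (t : (α → Fin q) × (α → Fin q)) :
      (q : ℝ) ^ ({a | t.1 a = t.2 a} : Set α).ncard =
        ∏ a, if t.1 a = t.2 a then (q : ℝ) else 1 := by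
    rw [Finset.prod_ite]
    simp [Set.ncard_eq_toFinset_card']
  have h2 : ∑ y : Fin q × Fin q, (if y.1 = y.2 then (q : ℝ) else 1) ≤ 2 * (q : ℝ) ^ 2 := by
    calc ∑ y : Fin q × Fin q, (if y.1 = y.2 then (q : ℝ) else 1)
        ≤ ∑ y : Fin q × Fin q, ((if y.1 = y.2 then (q : ℝ) else 0) + 1) := by
          gcongr with y
          split_ifs <;> simp
      _ = 2 * (q : ℝ) ^ 2 := by
          rw [Finset.sum_add_distrib, Fintype.sum_prod_type]
          simp
          ring
  calc _ = ∑ t : (α → Fin q) × (α → Fin q), ∏ a, if t.1 a = t.2 a then (q : ℝ) else 1 :=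
        Finset.sum_congr rfl fun t _ => h1 t
    _ = ∑ g : α → Fin q × Fin q, ∏ a, if (g a).1 = (g a).2 then (q : ℝ) else 1 :=
        ((Equiv.arrowProdEquivProdArrow α (fun _ => Fin q) (fun _ => Fin q)).sum_comp
          fun t => ∏ a, if t.1 a = t.2 a then (q : ℝ) else 1).symm
    _ = ∏ _a : α, ∑ y : Fin q × Fin q, (if y.1 = y.2 then (q : ℝ) else 1) := by
        rw [Finset.prod_univ_sum, Fintype.piFinset_univ]
    _ = (∑ y : Fin q × Fin q, (if y.1 = y.2 then (q : ℝ) else 1)) ^ Fintype.card α := by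
        rw [Finset.prod_const, Finset.card_univ]
    _ ≤ _ := by
        gcongr

open WCGame

variable [DecidableEq α] [DecidableEq β] [Fintype H.edgeSet] {φ : α × Fin q ↪ β}

open Classical in
lemma card_inter_copySet_le (f f' : α → Fin q) :
    (copySet (partiteEdge H φ) f ∩ copySet (partiteEdge H φ) f').card
      ≤ eIn H {a | f a = f' a} := by
  have hsub : copySet (partiteEdge H φ) f ∩ copySet (partiteEdge H φ) f' ⊆
      (Finset.univ.filter fun i : H.edgeSet => ∀ a ∈ (i : Sym2 α), f a = f' a).image
        (partiteEdge H φ f) := by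
    intro e he
    simp only [copySet, Finset.mem_inter, Finset.mem_image, Finset.mem_univ, true_and] at he
    obtain ⟨⟨i, rfl⟩, i', hi'⟩ := he
    have := eq_and_agree_of_partiteEdge_eq hi'.symm
    exact Finset.mem_image_of_mem _ (Finset.mem_filter.2 ⟨Finset.mem_univ _, this.2⟩)
  refine (Finset.card_le_card hsub).trans (Finset.card_image_le.trans ?_)
  rw [← Set.ncard_coe_finset, ← Set.ncard_image_of_injective _ Subtype.val_injective]
  refine Set.ncard_le_ncard ?_
  rintro _ ⟨i, hi, rfl⟩
  exact ⟨i.2, by simpa using hi⟩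

open Classical in
lemma pairTerm_le {b : ℕ} {ε : ℝ} (hb : 1 ≤ b) (hε : 0 ≤ ε)
    (hsub : ∀ s : Set α, 0 < eIn H s → (b : ℝ) ^ eIn H s ≤ ε * (q : ℝ) ^ s.ncard)
    (t : (α → Fin q) × (α → Fin q)) :
    (if Disjoint (copySet (partiteEdge H φ) t.1) (copySet (partiteEdge H φ) t.2) then 0
      else ((b : ℝ)⁻¹) ^ (pairSet (partiteEdge H φ) t).card)
      ≤ ε * ((b : ℝ)⁻¹) ^ (2 * Fintype.card H.edgeSet) *
        (q : ℝ) ^ ({a | t.1 a = t.2 a} : Set α).ncard := by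
  split_ifs with hd
  · positivity
  have hb1 : (1 : ℝ) ≤ b := by exact_mod_cast hb
  have hb0 : (0 : ℝ) < b := by linarith
  have hinter := card_inter_copySet_le (H := H) (φ := φ) t.1 t.2
  have hpos : 0 < eIn H {a | t.1 a = t.2 a} := by
    refine lt_of_lt_of_le (Finset.card_pos.2 ?_) hinter
    rwa [Finset.disjoint_iff_inter_eq_empty, ← Ne, ← Finset.nonempty_iff_ne_empty] at hd
  have hcard : 2 * Fintype.card H.edgeSet ≤
      (pairSet (partiteEdge H φ) t).card + eIn H {a | t.1 a = t.2 a} := by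
    have := Finset.card_union_add_card_inter (copySet (partiteEdge H φ) t.1)
      (copySet (partiteEdge H φ) t.2)
    rw [card_copySet partiteEdge_role_injective, card_copySet partiteEdge_role_injective] at this
    unfold pairSet
    omega
  calc ((b : ℝ)⁻¹) ^ (pairSet (partiteEdge H φ) t).card
      = ((b : ℝ)⁻¹) ^ ((pairSet (partiteEdge H φ) t).card + eIn H {a | t.1 a = t.2 a}) *
          (b : ℝ) ^ eIn H {a | t.1 a = t.2 a} := by
        rw [pow_add, mul_assoc, ← mul_pow, inv_mul_cancel₀ hb0.ne', one_pow, mul_one]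
    _ ≤ ((b : ℝ)⁻¹) ^ (2 * Fintype.card H.edgeSet) *
          (ε * (q : ℝ) ^ ({a | t.1 a = t.2 a} : Set α).ncard) := by
        refine mul_le_mul ?_ (hsub _ hpos) (by positivity) (by positivity)
        exact pow_le_pow_of_le_one (by positivity) (inv_le_one_of_one_le₀ hb1) hcard
    _ = _ := by ring

open Classical in
lemma waiterWins_partite {b k₀ : ℕ} {δ : ℝ} (hb : 1 ≤ b) (hk₀ : 27 ≤ k₀)
    (hsum : ∀ K, ∑ k ∈ Finset.Ico k₀ K, roundLoss k ≤ 1 / (64 * (Fintype.card H.edgeSet + 1)))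
    (hδ0 : 0 < δ) (hδ : δ ≤ 1 / (16 * k₀ * (Fintype.card H.edgeSet + 1))) (hq : 0 < q)
    (hsub : ∀ s : Set α, 0 < eIn H s →
      (b : ℝ) ^ eIn H s ≤ δ / 2 ^ Fintype.card α * (q : ℝ) ^ s.ncard) :
    WaiterWins b (fun S => (q : ℝ) ^ Fintype.card α * ((b : ℝ)⁻¹) ^ Fintype.card H.edgeSet / 4 ≤
        ((Finset.univ.filter fun f => copySet (partiteEdge H φ) f ⊆ S).card : ℝ)) ∅
      (Finset.univ.biUnion (roleSet (partiteEdge H φ))) := by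
  have hb0 : (0 : ℝ) < b := by exact_mod_cast hb
  have hq0 : (0 : ℝ) < q := by exact_mod_cast hq
  refine waiterWins_of_second_moment hb hk₀ hsum hδ0 hδ partiteEdge_role_injective
    (by positivity) (by simp) ?_
  calc _ ≤ ∑ t : (α → Fin q) × (α → Fin q), δ / 2 ^ Fintype.card α *
            ((b : ℝ)⁻¹) ^ (2 * Fintype.card H.edgeSet) *
            (q : ℝ) ^ ({a | t.1 a = t.2 a} : Set α).ncard :=
        Finset.sum_le_sum fun t _ => pairTerm_le hb (by positivity) hsub t
    _ ≤ δ / 2 ^ Fintype.card α * ((b : ℝ)⁻¹) ^ (2 * Fintype.card H.edgeSet) *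
          (2 * (q : ℝ) ^ 2) ^ Fintype.card α := by
        rw [← Finset.mul_sum]
        gcongr
        exact sum_pow_card_agree α q
    _ = _ := by
        field_simp
        ring

lemma roleSet_subset_edgeBoard [Finite β] :
    Finset.univ.biUnion (roleSet (partiteEdge H φ)) ⊆
      edgeBoard (SimpleGraph.completeGraph β) := by
  intro e he
  simp only [roleSet, Finset.mem_biUnion, Finset.mem_image, Finset.mem_univ, true_and] at he
  obtain ⟨⟨i, hi⟩, f, rfl⟩ := he
  induction i with
  | _ a a' =>
    have : a ≠ a' := H.ne_of_adj hi
    simp [edgeBoard, partiteEdge, this]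

end PartiteCopies

section CopyCount

open WCGame

variable {α β : Type*} {H : SimpleGraph α} {q : ℕ} [DecidableEq β] [Fintype H.edgeSet]
  {φ : α × Fin q ↪ β}

/-- The canonical copy of `H` described by `f`, inside a graph containing all its edges. -/
def partiteCopy {S : Finset (Sym2 β)} {f : α → Fin q}
    (hf : copySet (partiteEdge H φ) f ⊆ S) :
    SimpleGraph.Copy H (SimpleGraph.fromEdgeSet (S : Set (Sym2 β))) :=
  SimpleGraph.Hom.toCopy
    { toFun := fun a => φ (a, f a)
      map_rel' := fun {a a'} h => by
        refine (SimpleGraph.fromEdgeSet_adj _).2 ⟨?_, fun h' => h.ne ?_⟩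
        · exact hf (Finset.mem_image.2 ⟨⟨s(a, a'), h⟩, Finset.mem_univ _, rfl⟩)
        · exact congrArg Prod.fst (φ.injective h') }
    fun _ _ h => congrArg Prod.fst (φ.injective h)

lemma eq_of_toSubgraph_partiteCopy_eq {S : Finset (Sym2 β)} {f f' : α → Fin q}
    (hf : copySet (partiteEdge H φ) f ⊆ S) (hf' : copySet (partiteEdge H φ) f' ⊆ S)
    (h : (partiteCopy hf).toSubgraph = (partiteCopy hf').toSubgraph) : f = f' := by
  funext a
  have h1 : φ (a, f a) ∈ (partiteCopy hf').toSubgraph.verts :=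
    h ▸ ⟨a, trivial, rfl⟩
  obtain ⟨a', -, h2⟩ := h1
  obtain ⟨rfl, h3⟩ := Prod.mk.injEq .. ▸ φ.injective h2
  exact h3.symm

open Classical in
lemma card_copies_le_copyCount [Fintype α] [DecidableEq α] [Finite β] (S : Finset (Sym2 β)) :
    (Finset.univ.filter fun f => copySet (partiteEdge H φ) f ⊆ S).card ≤
      copyCount (SimpleGraph.fromEdgeSet (S : Set (Sym2 β))) H := by
  rw [← Set.ncard_coe_finset]
  refine Set.ncard_le_ncard_of_injOn
    (fun f => if hf : copySet (partiteEdge H φ) f ⊆ S then (partiteCopy hf).toSubgraph else ⊥)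
    ?_ ?_ (Set.toFinite _)
  · intro f hf
    have hf : copySet (partiteEdge H φ) f ⊆ S := by simpa using hf
    simpa only [dif_pos hf] using ⟨(partiteCopy hf).isoToSubgraph.symm⟩
  · intro f hf f' hf' h
    have hf : copySet (partiteEdge H φ) f ⊆ S := by simpa using hf
    have hf' : copySet (partiteEdge H φ) f' ⊆ S := by simpa using hf'
    simp only [dif_pos hf, dif_pos hf'] at h
    exact eq_of_toSubgraph_partiteCopy_eq hf hf' h

end CopyCount

lemma pow_eIn_le {α : Type*} [Fintype α] {H : SimpleGraph α} (hH : H.edgeSet.Nonempty)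
    {n b q C : ℕ} {c : ℝ} (hc0 : 0 < c) (hc1 : c ≤ 1) (hC : 1 ≤ C) (hn : n ≤ C * q)
    (hn0 : 1 ≤ n) (hbn : (b : ℝ) ≤ c * (n : ℝ) ^ (1 / maxDensity H)) {s : Set α}
    (hs : 0 < eIn H s) :
    (b : ℝ) ^ eIn H s ≤ c * (C : ℝ) ^ Fintype.card α * (q : ℝ) ^ s.ncard := by
  have hm := maxDensity_pos hH
  have hn1 : (1 : ℝ) ≤ n := by exact_mod_cast hn0
  have hC1 : (1 : ℝ) ≤ C := by exact_mod_cast hC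
  have hcard : s.ncard ≤ Fintype.card α := by
    simpa [Nat.card_eq_fintype_card] using Set.ncard_le_card s
  calc (b : ℝ) ^ eIn H s ≤ (c * (n : ℝ) ^ (1 / maxDensity H)) ^ eIn H s := by gcongr
    _ = c ^ eIn H s * (n : ℝ) ^ (1 / maxDensity H * eIn H s) := by
        rw [mul_pow, Real.rpow_mul_natCast (by positivity)]
    _ ≤ c * (n : ℝ) ^ (s.ncard : ℝ) := by
        gcongr
        · exact pow_le_of_le_one hc0.le hc1 hs.ne'
        · rw [one_div_mul_eq_div, div_le_iff₀' hm]
          exact eIn_le_maxDensity_mul H (nonempty_of_eIn_pos hs)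
    _ = c * (n : ℝ) ^ s.ncard := by rw [Real.rpow_natCast]
    _ ≤ c * ((C : ℝ) * q) ^ s.ncard := by
        gcongr
        exact_mod_cast hn
    _ ≤ c * ((C : ℝ) ^ Fintype.card α * (q : ℝ) ^ s.ncard) := by
        rw [mul_pow]
        gcongr
    _ = _ := by ring

end GraphDefs

namespace WCGame

lemma WaiterCanEnsure.imp {X : Type*} [DecidableEq X] {board : Finset X} {b : ℕ}
    {P Q : Finset X → Prop} (h : WaiterCanEnsure board b P) (hPQ : ∀ S, P S → Q S) :
    WaiterCanEnsure board b Q := by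
  obtain ⟨W, hW, hP⟩ := h
  exact ⟨W, hW, fun C hC => hPQ _ (hP C hC)⟩

end WCGame

open Filter GraphDefs WCGame in
/-- For every graph `H` with at least one edge there exist `c, γ > 0`
such that for all sufficiently large `n` and every integer `b` with
`1 ≤ b ≤ c·n^(1/m(H))`, in the `b`-Waiter-Client game on the edges of `K_n`,
Waiter can ensure that Client's final graph contains at least
`γ·n^(v(H))/b^(e(H))` subgraphs isomorphic to `H`. -/
theorem waiter_client_small_subgraphs {α : Type*} [Fintype α] [DecidableEq α]
    (H : SimpleGraph α) (hH : H.edgeSet.Nonempty) :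
    ∃ c γ : ℝ, 0 < c ∧ 0 < γ ∧
      ∀ᶠ n : ℕ in atTop, ∀ b : ℕ, 1 ≤ b →
        (b : ℝ) ≤ c * (n : ℝ) ^ (1 / maxDensity H) →
        WaiterCanEnsure (edgeBoard (SimpleGraph.completeGraph (Fin n))) b
          (fun S =>
            γ * (n : ℝ) ^ (Fintype.card α) / (b : ℝ) ^ (H.edgeSet.ncard) ≤
              (copyCount (SimpleGraph.fromEdgeSet (↑S : Set (Sym2 (Fin n)))) H : ℝ)) := by

  classical
  set v := Fintype.card α with hv
  set m := Fintype.card H.edgeSet with hm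
  have hme : H.edgeSet.ncard = m := by
    rw [hm, ← Nat.card_eq_fintype_card, Nat.card_coe_set_eq]
  have hvpos : 0 < v := by
    obtain ⟨e, he⟩ := hH
    induction e with
    | _ a b => exact Fintype.card_pos_iff.2 ⟨a⟩
  obtain ⟨k₀, hk₀, hsum⟩ := exists_sum_roundLoss_le (ε := 1 / (64 * ((m : ℝ) + 1)))
    (by positivity)
  have hk₀' : (0 : ℝ) < k₀ := by exact_mod_cast (by omega : 0 < k₀)
  have hv0 : (0 : ℝ) < v := by exact_mod_cast hvpos
  set δ : ℝ := 1 / (16 * k₀ * (m + 1)) with hδ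
  have hδ0 : 0 < δ := by positivity
  set c : ℝ := min 1 (δ / (2 ^ v * (2 * (v : ℝ)) ^ v)) with hc
  have hc0 : 0 < c := lt_min one_pos (by positivity)
  refine ⟨c, 1 / (4 * (2 * (v : ℝ)) ^ v), hc0, by positivity, ?_⟩
  filter_upwards [eventually_ge_atTop v] with n hn b hb hbn
  have hb0 : (0 : ℝ) < b := by exact_mod_cast hb
  set q := n / v with hqd
  have hq : 0 < q := Nat.div_pos hn hvpos
  have hnq : n ≤ 2 * v * q := by
    have h1 := Nat.div_add_mod n v
    have h2 := Nat.mod_lt n hvpos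
    have h3 : v * 1 ≤ v * q := Nat.mul_le_mul_left v hq
    rw [← hqd] at h1
    nlinarith
  obtain ⟨φ⟩ : Nonempty (α × Fin q ↪ Fin n) :=
    Function.Embedding.nonempty_of_card_le (by simpa using Nat.mul_div_le n v)
  have hsub (s : Set α) (hs : 0 < eIn H s) :
      (b : ℝ) ^ eIn H s ≤ δ / 2 ^ v * (q : ℝ) ^ s.ncard := by
    refine (pow_eIn_le hH hc0 (min_le_left _ _) (by omega) hnq (by omega) hbn hs).trans ?_
    gcongr
    calc c * ((2 * v : ℕ) : ℝ) ^ v ≤ δ / (2 ^ v * (2 * (v : ℝ)) ^ v) * (2 * (v : ℝ)) ^ v := by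
          push_cast
          gcongr
          exact min_le_right _ _
      _ = δ / 2 ^ v := by field_simp
  refine (((waiterWins_partite (φ := φ) hb hk₀ hsum hδ0 le_rfl hq hsub).mono
    roleSet_subset_edgeBoard).waiterCanEnsure hb).imp fun S hS => ?_
  refine le_trans ?_ (hS.trans (Nat.cast_le.2 (card_copies_le_copyCount S)))
  have hnq' : (n : ℝ) ≤ 2 * v * q := by exact_mod_cast hnq
  rw [hme]
  calc 1 / (4 * (2 * (v : ℝ)) ^ v) * (n : ℝ) ^ v / (b : ℝ) ^ m
      ≤ 1 / (4 * (2 * (v : ℝ)) ^ v) * (2 * v * q) ^ v / (b : ℝ) ^ m := by gcongr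
    _ = (q : ℝ) ^ v * ((b : ℝ)⁻¹) ^ m / 4 := by
        rw [mul_pow _ (q : ℝ), inv_pow]
        field_simp
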